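/- Let G and H be orbitally similar connected simple graphs on finite vertex types V and W respectively. Then G and H have the same degree moments of every order: for every r : ℕ, Fintype.card W * ∑_{v ∈ V} (G.degree v)^r = Fintype.card V * ∑_{w ∈ W} (H.degree w)^r. In particular (r = 1, using the degree sum formula) G and H have the same average degree and the same edge–vertex ratio, i.e. G.edgeFinset.card * Fintype.card W = H.edgeFinset.card * Fintype.card V, and they have the same degree-variance. -/

import Mathlib

open Classical Finset

/-- `O : Fin ℓ → Finset V` is an orbit enumeration of the graph `G`:
every vertex lies in exactly one `O i`, and each `O i` is an orbit of the
automorphism group of `G` acting on the vertices. -/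
def IsOrbitEnum {V : Type*} (G : SimpleGraph V) {ℓ : ℕ} (O : Fin ℓ → Finset V) : Prop :=
  (∀ v : V, ∃! i, v ∈ O i) ∧
  ∀ i : Fin ℓ, ∃ w : V, ∀ v : V, v ∈ O i ↔ ∃ φ : G ≃g G, φ w = v

/-- `S` is the orbit divisor matrix of `G` relative to the orbit enumeration `O`:
for every vertex `u ∈ O i`, the number of vertices of `O j` adjacent to `u` is `S i j`. -/
def IsOrbitDivisorMatrix {V : Type*} (G : SimpleGraph V) {ℓ : ℕ}
    (O : Fin ℓ → Finset V) (S : Matrix (Fin ℓ) (Fin ℓ) ℕ) : Prop :=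
  ∀ i j : Fin ℓ, ∀ u ∈ O i, ((O j).filter fun v => G.Adj u v).card = S i j

/-- Two graphs are orbitally similar if they admit orbit enumerations with a
common orbit divisor matrix. -/
def OrbitallySimilar {V W : Type*} (G : SimpleGraph V) (H : SimpleGraph W) : Prop :=
  ∃ (ℓ : ℕ) (O : Fin ℓ → Finset V) (Q : Fin ℓ → Finset W) (S : Matrix (Fin ℓ) (Fin ℓ) ℕ),
    IsOrbitEnum G O ∧ IsOrbitEnum H Q ∧
    IsOrbitDivisorMatrix G O S ∧ IsOrbitDivisorMatrix H Q S

theorem IsOrbitEnum.nonempty {V : Type*} {G : SimpleGraph V} {ℓ : ℕ} {O : Fin ℓ → Finset V}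
    (hO : IsOrbitEnum G O) (i : Fin ℓ) : (O i).Nonempty := by
  obtain ⟨w, hw⟩ := hO.2 i
  exact ⟨w, (hw w).2 ⟨RelIso.refl _, rfl⟩⟩

theorem IsOrbitEnum.sum_eq {V M : Type*} [Fintype V] [AddCommMonoid M] {G : SimpleGraph V} {ℓ : ℕ}
    {O : Fin ℓ → Finset V} (hO : IsOrbitEnum G O) (f : V → M) :
    ∑ v, f v = ∑ i, ∑ v ∈ O i, f v := by
  choose p hp hpu using hO.1
  have hmem (v : V) (i : Fin ℓ) : v ∈ O i ↔ p v = i :=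
    ⟨fun h => (hpu v i h).symm, fun h => h ▸ hp v⟩
  rw [← Finset.sum_fiberwise univ p f]
  refine Finset.sum_congr rfl fun i _ => Finset.sum_congr ?_ fun _ _ => rfl
  ext v
  simp [hmem]

theorem IsOrbitDivisorMatrix.degree_eq {V : Type*} [Fintype V] {G : SimpleGraph V}
    [DecidableRel G.Adj] {ℓ : ℕ} {O : Fin ℓ → Finset V} {S : Matrix (Fin ℓ) (Fin ℓ) ℕ}
    (hS : IsOrbitDivisorMatrix G O S) (hO : IsOrbitEnum G O) {i : Fin ℓ} {u : V} (hu : u ∈ O i) :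
    G.degree u = ∑ j, S i j := by
  rw [← G.card_neighborFinset_eq_degree, G.neighborFinset_eq_filter, Finset.card_filter,
    hO.sum_eq]
  refine Finset.sum_congr rfl fun j _ => ?_
  rw [← hS i j u hu, Finset.card_filter]
  exact Finset.sum_congr rfl fun v _ => by congr

/-- Double counting of the edges between two orbits. -/
theorem IsOrbitDivisorMatrix.card_mul_eq {V : Type*} {G : SimpleGraph V} {ℓ : ℕ}
    {O : Fin ℓ → Finset V} {S : Matrix (Fin ℓ) (Fin ℓ) ℕ}
    (hS : IsOrbitDivisorMatrix G O S) (i j : Fin ℓ) :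
    (O i).card * S i j = (O j).card * S j i := by
  refine Finset.card_mul_eq_card_mul G.Adj (fun u hu => hS i j u hu) fun v hv => ?_
  rw [← hS j i v hv, Finset.bipartiteBelow]
  simp only [G.adj_comm]

/-- For a connected graph, a common orbit divisor matrix determines the ratios of orbit sizes. -/
theorem IsOrbitDivisorMatrix.card_mul_card_eq {V W : Type*} {G : SimpleGraph V}
    {H : SimpleGraph W} {ℓ : ℕ} {O : Fin ℓ → Finset V} {Q : Fin ℓ → Finset W}
    {S : Matrix (Fin ℓ) (Fin ℓ) ℕ} (hG : G.Connected) (hO : IsOrbitEnum G O)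
    (hGS : IsOrbitDivisorMatrix G O S) (hHS : IsOrbitDivisorMatrix H Q S) (i j : Fin ℓ) :
    (O i).card * (Q j).card = (O j).card * (Q i).card := by
  obtain ⟨u, hu⟩ := hO.nonempty i
  obtain ⟨v, hv⟩ := hO.nonempty j
  obtain ⟨w⟩ := hG.preconnected u v
  induction w generalizing i with
  | nil => rw [(hO.1 _).unique hu hv]
  | @cons a b c hab _ ih =>
    obtain ⟨k, hk, -⟩ := hO.1 b
    have hjk := ih k hk hv
    have hpos : 0 < S k i := by
      rw [← hGS k i b hk]
      exact Finset.card_pos.2 ⟨a, by simp [hu, hab.symm]⟩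
    have hik : (O i).card * (Q k).card = (O k).card * (Q i).card := by
      refine Nat.eq_of_mul_eq_mul_right hpos ?_
      linear_combination (Q i).card * hGS.card_mul_eq i k - (O i).card * hHS.card_mul_eq i k
    refine Nat.eq_of_mul_eq_mul_left (hO.nonempty k).card_pos ?_
    linear_combination (O i).card * hjk + (O j).card * hik

theorem sum_sub_mean_sq_div_card {ι : Type*} [Fintype ι] [Nonempty ι] (x : ι → ℝ) :
    (∑ i, (x i - (∑ k, x k) / Fintype.card ι) ^ 2) / Fintype.card ι
      = (∑ i, x i ^ 2) / Fintype.card ι - ((∑ i, x i) / Fintype.card ι) ^ 2 := by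
  have hn : (Fintype.card ι : ℝ) ≠ 0 := Nat.cast_ne_zero.2 Fintype.card_ne_zero
  simp only [sub_sq, Finset.sum_add_distrib, Finset.sum_sub_distrib, ← Finset.sum_mul,
    ← Finset.mul_sum, Finset.sum_const, Finset.card_univ, nsmul_eq_mul]
  field_simp
  ring

theorem OrbitallySimilar.card_mul_sum_degree_pow_eq {V W : Type*} [Fintype V] [Fintype W]
    {G : SimpleGraph V} {H : SimpleGraph W} [DecidableRel G.Adj] [DecidableRel H.Adj]
    (hG : G.Connected) (hGH : OrbitallySimilar G H) (r : ℕ) :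
    Fintype.card W * ∑ v, G.degree v ^ r = Fintype.card V * ∑ w, H.degree w ^ r := by
  obtain ⟨ℓ, O, Q, S, hO, hQ, hGS, hHS⟩ := hGH
  have hV : ∑ v, G.degree v ^ r = ∑ i, (O i).card * (∑ j, S i j) ^ r := by
    rw [hO.sum_eq]
    exact Finset.sum_congr rfl fun i _ =>
      Finset.sum_const_nat fun v hv => by rw [hGS.degree_eq hO hv]
  have hW : ∑ w, H.degree w ^ r = ∑ i, (Q i).card * (∑ j, S i j) ^ r := by
    rw [hQ.sum_eq]
    exact Finset.sum_congr rfl fun i _ =>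
      Finset.sum_const_nat fun w hw => by rw [hHS.degree_eq hQ hw]
  have hcV : Fintype.card V = ∑ i, (O i).card := by
    simpa using hO.sum_eq fun _ => (1 : ℕ)
  have hcW : Fintype.card W = ∑ i, (Q i).card := by
    simpa using hQ.sum_eq fun _ => (1 : ℕ)
  rw [hV, hW, hcV, hcW, Finset.sum_mul_sum, Finset.sum_mul_sum]
  refine Finset.sum_congr rfl fun i _ => Finset.sum_congr rfl fun j _ => ?_
  linear_combination (∑ k, S j k) ^ r *
    IsOrbitDivisorMatrix.card_mul_card_eq hG hO hGS hHS j i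

/-- Orbitally similar connected graphs have the same degree moments of every
order; in particular they have the same edge-vertex ratio and the same
degree-variance. -/
theorem degree_moments_eq_of_orbitally_similar {V W : Type*}
    [Fintype V] [Fintype W] [DecidableEq V] [DecidableEq W]
    (G : SimpleGraph V) (H : SimpleGraph W) [DecidableRel G.Adj] [DecidableRel H.Adj]
    (hG : G.Connected) (hH : H.Connected) (hGH : OrbitallySimilar G H) :
    (∀ r : ℕ,
      Fintype.card W * ∑ v : V, (G.degree v) ^ r
        = Fintype.card V * ∑ w : W, (H.degree w) ^ r) ∧
    G.edgeFinset.card * Fintype.card W = H.edgeFinset.card * Fintype.card V ∧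
    (∑ v : V, ((G.degree v : ℝ)
        - (∑ u : V, (G.degree u : ℝ)) / Fintype.card V) ^ 2) / Fintype.card V
      = (∑ w : W, ((H.degree w : ℝ)
        - (∑ u : W, (H.degree u : ℝ)) / Fintype.card W) ^ 2) / Fintype.card W := by
  have hmom := hGH.card_mul_sum_degree_pow_eq hG
  refine ⟨hmom, ?_, ?_⟩
  · have h := hmom 1
    simp only [pow_one, SimpleGraph.sum_degrees_eq_twice_card_edges] at h
    linarith
  · have := hG.nonempty
    have := hH.nonempty
    have hV : (Fintype.card V : ℝ) ≠ 0 := Nat.cast_ne_zero.2 Fintype.card_ne_zero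
    have hW : (Fintype.card W : ℝ) ≠ 0 := Nat.cast_ne_zero.2 Fintype.card_ne_zero
    have hdiv (r : ℕ) : (∑ v, (G.degree v : ℝ) ^ r) / Fintype.card V
        = (∑ w, (H.degree w : ℝ) ^ r) / Fintype.card W := by
      rw [div_eq_div_iff hV hW, mul_comm, mul_comm _ (Fintype.card V : ℝ)]
      exact_mod_cast hmom r
    have hmean := hdiv 1
    simp only [pow_one] at hmean
    rw [sum_sub_mean_sq_div_card, sum_sub_mean_sq_div_card, hdiv 2, hmean]
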